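/- Let S ⊆ I be equivalent to a triangular set and let X ≠ Y be tables in the same S-fiber with Z = X − Y. Assume that no block of S contains both a cell where z > 0 and a cell where z < 0. Suppose there exist i ≠ i', j ≠ j' with B(i,i';j,j') ∈ B₀(S) and a sign ε ∈ {+1,−1} such that: the block of S containing (i',j) contains a cell with ε·z < 0, the block containing (i,j') contains a cell with ε·z < 0, and the block containing (i,j) or the block containing (i',j') contains a cell with ε·z > 0. Then ‖X − Y‖₁ can be reduced by B₀(S). -/

import Mathlib

open Finset

/-- A move for the subtable sum problem: all row sums and column sums are zero,
and the sum over the subtable `S` is zero. -/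
def isMove {R C : ℕ} (S : Finset (Fin R × Fin C)) (z : Fin R × Fin C → ℤ) : Prop :=
  (∀ i : Fin R, ∑ j : Fin C, z (i, j) = 0) ∧
  (∀ j : Fin C, ∑ i : Fin R, z (i, j) = 0) ∧
  (∑ p ∈ S, z p = 0)

/-- Two tables lie in the same `S`-fiber: equal row sums, column sums and `S`-sums. -/
def sameFiber {R C : ℕ} (S : Finset (Fin R × Fin C)) (x y : Fin R × Fin C → ℕ) : Prop :=
  (∀ i : Fin R, ∑ j : Fin C, x (i, j) = ∑ j : Fin C, y (i, j)) ∧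
  (∀ j : Fin C, ∑ i : Fin R, x (i, j) = ∑ i : Fin R, y (i, j)) ∧
  (∑ p ∈ S, x p = ∑ p ∈ S, y p)

/-- The basic move `B(i,i';j,j')`: +1 at `(i,j)` and `(i',j')`, −1 at `(i,j')` and `(i',j)`. -/
def basicMove {R C : ℕ} (i i' : Fin R) (j j' : Fin C) : Fin R × Fin C → ℤ := fun p =>
  (if p = (i, j) then 1 else 0) + (if p = (i', j') then 1 else 0)
    - (if p = (i, j') then 1 else 0) - (if p = (i', j) then 1 else 0)

/-- `B₀(S)`: the set of basic moves that are moves for `S`. -/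
def B0 {R C : ℕ} (S : Finset (Fin R × Fin C)) : Set (Fin R × Fin C → ℤ) :=
  { z | ∃ i i' : Fin R, ∃ j j' : Fin C, i ≠ i' ∧ j ≠ j' ∧
      z = basicMove i i' j j' ∧ isMove S z }

/-- `ℬ` is a Markov basis for `S`: a finite, sign-invariant set of moves for `S` connecting
any two distinct tables of a common `S`-fiber while staying nonnegative along the way. -/
def isMarkovBasis {R C : ℕ} (S : Finset (Fin R × Fin C))
    (ℬ : Set (Fin R × Fin C → ℤ)) : Prop :=
  ℬ.Finite ∧ (∀ z ∈ ℬ, isMove S z) ∧ (∀ z ∈ ℬ, -z ∈ ℬ) ∧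
  ∀ x y : Fin R × Fin C → ℕ, sameFiber S x y → x ≠ y →
    ∃ (α : ℕ) (B : ℕ → (Fin R × Fin C → ℤ)),
      0 < α ∧ (∀ t < α, B t ∈ ℬ) ∧
      (∀ p, (y p : ℤ) = (x p : ℤ) + ∑ t ∈ Finset.range α, B t p) ∧
      (∀ a, 1 ≤ a → a ≤ α → ∀ p, 0 ≤ (x p : ℤ) + ∑ t ∈ Finset.range a, B t p)

/-- `‖X − Y‖₁` can be reduced by `B₀(S)` (Definition 2 of the paper). -/
def normReducible {R C : ℕ} (S : Finset (Fin R × Fin C))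
    (x y : Fin R × Fin C → ℕ) : Prop :=
  ∃ (τp τm : ℕ) (Bp Bm : ℕ → (Fin R × Fin C → ℤ)),
    0 < τp + τm ∧
    (∀ t < τp, Bp t ∈ B0 S) ∧ (∀ t < τm, Bm t ∈ B0 S) ∧
    (∀ a, 1 ≤ a → a ≤ τp → ∀ p, 0 ≤ (x p : ℤ) + ∑ t ∈ Finset.range a, Bp t p) ∧
    (∀ a, 1 ≤ a → a ≤ τm → ∀ p, 0 ≤ (y p : ℤ) - ∑ t ∈ Finset.range a, Bm t p) ∧
    (∑ p : Fin R × Fin C,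
        |(x p : ℤ) - (y p : ℤ) + ∑ t ∈ Finset.range τp, Bp t p
          + ∑ t ∈ Finset.range τm, Bm t p|)
      < ∑ p : Fin R × Fin C, |(x p : ℤ) - (y p : ℤ)|

/-- `T` exhibits pattern `P`. -/
def patternP {R C : ℕ} (T : Finset (Fin R × Fin C)) : Prop :=
  ∃ i₁ i₂ : Fin R, ∃ j₁ j₂ j₃ : Fin C,
    i₁ ≠ i₂ ∧ j₁ ≠ j₂ ∧ j₁ ≠ j₃ ∧ j₂ ≠ j₃ ∧
    (i₁, j₁) ∈ T ∧ (i₂, j₂) ∈ T ∧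
    (i₁, j₂) ∉ T ∧ (i₂, j₁) ∉ T ∧ (i₁, j₃) ∉ T ∧ (i₂, j₃) ∉ T

/-- `T` exhibits pattern `Pᵗ` (the transpose of pattern `P`). -/
def patternPt {R C : ℕ} (T : Finset (Fin R × Fin C)) : Prop :=
  ∃ i₁ i₂ i₃ : Fin R, ∃ j₁ j₂ : Fin C,
    i₁ ≠ i₂ ∧ i₁ ≠ i₃ ∧ i₂ ≠ i₃ ∧ j₁ ≠ j₂ ∧
    (i₁, j₁) ∈ T ∧ (i₂, j₂) ∈ T ∧
    (i₂, j₁) ∉ T ∧ (i₁, j₂) ∉ T ∧ (i₃, j₁) ∉ T ∧ (i₃, j₂) ∉ T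

/-- `S` is equivalent to a 2×2 block diagonal set. -/
def isBlockDiag {R C : ℕ} (S : Finset (Fin R × Fin C)) : Prop :=
  ∃ (R₁ : Finset (Fin R)) (C₁ : Finset (Fin C)),
    R₁.Nonempty ∧ R₁ ≠ Finset.univ ∧ C₁.Nonempty ∧ C₁ ≠ Finset.univ ∧
    S = R₁ ×ˢ C₁ ∪ R₁ᶜ ×ˢ C₁ᶜ

/-- `S` is equivalent to a triangular set: its row slices are totally ordered by inclusion. -/
def isTriangular {R C : ℕ} (S : Finset (Fin R × Fin C)) : Prop :=
  ∀ i i' : Fin R,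
    (∀ j : Fin C, (i, j) ∈ S → (i', j) ∈ S) ∨ (∀ j : Fin C, (i', j) ∈ S → (i, j) ∈ S)

/-- Two cells lie in the same block of `S`: equal row slices and equal column slices. -/
def sameBlock {R C : ℕ} (S : Finset (Fin R × Fin C)) (p q : Fin R × Fin C) : Prop :=
  (∀ j : Fin C, (p.1, j) ∈ S ↔ (q.1, j) ∈ S) ∧ (∀ i : Fin R, (i, p.2) ∈ S ↔ (i, q.2) ∈ S)

/-- The `n × (n+1)` staircase set `{(i,j) : j ≤ i}` (with 1-based numbering), all of whose
blocks are single cells. -/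
def staircase (n : ℕ) : Finset (Fin n × Fin (n + 1)) :=
  Finset.univ.filter (fun p => (p.2 : ℕ) ≤ (p.1 : ℕ))

/-- Condition (★) with threshold `i₀`: rows up to `i₀` are nonnegative at both boundary
columns, and rows after `i₀` are nonpositive there. -/
def starCond {n : ℕ} (z : Fin n × Fin (n + 1) → ℤ) (i₀ : Fin n) : Prop :=
  (∀ i : Fin n, i ≤ i₀ → 0 ≤ z (i, 0) ∧ 0 ≤ z (i, Fin.last n)) ∧
  (∀ i : Fin n, i₀ < i → z (i, 0) ≤ 0 ∧ z (i, Fin.last n) ≤ 0)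

/-- `i₁` is a last nonzero boundary row of `z`. -/
def lastBoundaryRow {n : ℕ} (z : Fin n × Fin (n + 1) → ℤ) (i₁ : Fin n) : Prop :=
  z (i₁, 0) ≤ 0 ∧ z (i₁, Fin.last n) ≤ 0 ∧
  (z (i₁, 0) < 0 ∨ z (i₁, Fin.last n) < 0) ∧
  (∀ i : Fin n, i₁ < i → z (i, 0) = 0 ∧ z (i, Fin.last n) = 0)

/-- Indicator form of the `S`-condition for a basic move. -/
lemma basicMove_sum {R C : ℕ} (S : Finset (Fin R × Fin C)) (i i' : Fin R) (j j' : Fin C) :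
    ∑ p ∈ S, basicMove i i' j j' p =
      (if (i, j) ∈ S then 1 else 0) + (if (i', j') ∈ S then 1 else 0)
        - (if (i, j') ∈ S then 1 else 0) - (if (i', j) ∈ S then 1 else 0) := by
  simp [basicMove, Finset.sum_add_distrib, Finset.sum_sub_distrib]

lemma basicMove_row {R C : ℕ} (i i' : Fin R) (j j' : Fin C) (a : Fin R) :
    ∑ b : Fin C, basicMove i i' j j' (a, b) = 0 := by
  simp only [basicMove, Prod.mk.injEq, Finset.sum_add_distrib, Finset.sum_sub_distrib, ite_and]
  by_cases h1 : a = i <;> by_cases h2 : a = i' <;> simp [h1, h2]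

lemma basicMove_col {R C : ℕ} (i i' : Fin R) (j j' : Fin C) (b : Fin C) :
    ∑ a : Fin R, basicMove i i' j j' (a, b) = 0 := by
  simp only [basicMove, Prod.mk.injEq, Finset.sum_add_distrib, Finset.sum_sub_distrib,
    and_comm, ite_and]
  by_cases h1 : b = j <;> by_cases h2 : b = j' <;> simp [h1, h2]

lemma basicMove_mem {R C : ℕ} (S : Finset (Fin R × Fin C)) (i i' : Fin R) (j j' : Fin C)
    (hi : i ≠ i') (hj : j ≠ j') (h : ∑ p ∈ S, basicMove i i' j j' p = 0) :
    basicMove i i' j j' ∈ B0 S :=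
  ⟨i, i', j, j', hi, hj, rfl, basicMove_row _ _ _ _, basicMove_col _ _ _ _, h⟩

lemma basicMove_neg {R C : ℕ} (i i' : Fin R) (j j' : Fin C) :
    -basicMove i i' j j' = basicMove i i' j' j := by
  funext p
  simp only [basicMove, Pi.neg_apply]
  ring

lemma B0_neg {R C : ℕ} (S : Finset (Fin R × Fin C)) (z : Fin R × Fin C → ℤ) (h : z ∈ B0 S) :
    -z ∈ B0 S := by
  obtain ⟨i, i', j, j', hi, hj, rfl, hm⟩ := h
  rw [basicMove_neg]
  refine basicMove_mem S i i' j' j hi hj.symm ?_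
  rw [← basicMove_neg]
  simp [Finset.sum_neg_distrib, hm.2.2]

/-- One-sided reducibility: only the second table moves. -/
def Red {R C : ℕ} (S : Finset (Fin R × Fin C)) (x y : Fin R × Fin C → ℤ) : Prop :=
  ∃ (n : ℕ) (B : ℕ → (Fin R × Fin C → ℤ)), 0 < n ∧ (∀ t < n, B t ∈ B0 S) ∧
    (∀ a, 1 ≤ a → a ≤ n → ∀ p, 0 ≤ y p - ∑ t ∈ Finset.range a, B t p) ∧
    ∑ p, |x p - y p + ∑ t ∈ Finset.range n, B t p| < ∑ p, |x p - y p|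

lemma Red.base {R C : ℕ} {S : Finset (Fin R × Fin C)} {x y M : Fin R × Fin C → ℤ}
    (hM : M ∈ B0 S) (h0 : ∀ p, 0 ≤ y p - M p)
    (hlt : ∑ p, |x p - y p + M p| < ∑ p, |x p - y p|) : Red S x y := by
  refine ⟨1, fun _ => M, one_pos, fun _ _ => hM, ?_, by simpa using hlt⟩
  intro a h1 h2 p
  obtain rfl : a = 1 := by omega
  simpa using h0 p

lemma Red.step {R C : ℕ} {S : Finset (Fin R × Fin C)} {x y M : Fin R × Fin C → ℤ}
    (hM : M ∈ B0 S) (h0 : ∀ p, 0 ≤ y p - M p)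
    (hle : ∑ p, |x p - y p + M p| ≤ ∑ p, |x p - y p|)
    (h : Red S x (fun p => y p - M p)) : Red S x y := by
  obtain ⟨n, B, hn, hB, hpos, hlt⟩ := h
  refine ⟨n + 1, fun t => if t = 0 then M else B (t - 1), by omega, ?_, ?_, ?_⟩
  · intro t ht
    by_cases h : t = 0
    · simpa [h] using hM
    · simpa [h] using hB (t - 1) (by omega)
  · intro a h1 h2 p
    obtain ⟨b, rfl⟩ : ∃ b, a = b + 1 := ⟨a - 1, by omega⟩
    rw [Finset.sum_range_succ']
    simp only [Nat.add_eq_zero_iff, one_ne_zero, and_false, if_false, if_true, Nat.add_sub_cancel]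
    rcases Nat.eq_zero_or_pos b with rfl | hb
    · simpa using h0 p
    · have := hpos b hb (by omega) p
      linarith
  · refine lt_of_lt_of_le (lt_of_eq_of_lt ?_ hlt) (le_trans (le_of_eq ?_) hle)
    · refine Finset.sum_congr rfl fun p _ => ?_
      rw [Finset.sum_range_succ']
      simp only [Nat.add_eq_zero_iff, one_ne_zero, and_false, if_false, if_true,
        Nat.add_sub_cancel]
      congr 1
      ring
    · refine Finset.sum_congr rfl fun p _ => ?_
      congr 1
      ring

/-- Effect of a single basic move on nonnegativity and on the norm. -/
lemma move_effect {R C : ℕ} (x y : Fin R × Fin C → ℤ) (hx : ∀ p, 0 ≤ x p) (hy : ∀ p, 0 ≤ y p)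
    (p r : Fin R) (q s : Fin C) (hpr : p ≠ r) (hqs : q ≠ s)
    (h1 : x (p, s) - y (p, s) < 0) (h2 : x (r, q) - y (r, q) < 0) :
    (∀ c, 0 ≤ y c - basicMove p r s q c) ∧
    (∑ c, |x c - y c + basicMove p r s q c| ≤ ∑ c, |x c - y c|) ∧
    (0 < x (p, q) - y (p, q) →
      ∑ c, |x c - y c + basicMove p r s q c| < ∑ c, |x c - y c|) := by
  have key : ∀ w : ℤ, (∀ t : ℤ, t = x (p, q) - y (p, q) → |t - 1| ≤ |t| + w) →
      ∑ c, |x c - y c + basicMove p r s q c| ≤ ∑ c, |x c - y c| + (w - 1) := by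
    intro w hw
    have : ∀ c, |x c - y c + basicMove p r s q c| ≤ |x c - y c| +
        ((if c = (p, q) then w else 0) + (if c = (r, s) then 1 else 0)
          + (if c = (p, s) then -1 else 0) + (if c = (r, q) then -1 else 0)) := by
      rintro ⟨a, b⟩
      simp only [basicMove, Prod.mk.injEq]
      by_cases ha : a = p
      · subst ha
        by_cases hb : b = q
        · subst hb
          have := hw _ rfl
          simpa [hpr, hqs, ← sub_eq_add_neg] using this
        · by_cases hb' : b = s
          · subst hb'
            simp [hpr, hb]
            rw [abs_of_neg h1, abs_of_nonpos (by omega)]; omega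
          · simp [hb, hb', hpr]
      · by_cases ha' : a = r
        · subst ha'
          by_cases hb : b = q
          · subst hb
            simp [ha, hqs]
            rw [abs_of_neg h2, abs_of_nonpos (by omega)]; omega
          · by_cases hb' : b = s
            · subst hb'
              simp [ha, hb]
              have := abs_sub (x (a, b) - y (a, b)) 1
              simpa [← sub_eq_add_neg] using this
            · simp [hb, hb', ha]
        · simp [ha, ha']
    refine (Finset.sum_le_sum fun c _ => this c).trans (le_of_eq ?_)
    simp [Finset.sum_add_distrib]
    ring
  refine ⟨?_, ?_, ?_⟩
  · rintro ⟨a, b⟩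
    have e1 := hx (p, s)
    have e2 := hx (r, q)
    have e3 := hy (a, b)
    simp only [basicMove, Prod.mk.injEq]
    by_cases ha : a = p
    · subst ha
      by_cases hb : b = s
      · subst hb
        simp [hpr, hqs.symm]; omega
      · simp [hpr, hb]; split_ifs <;> omega
    · by_cases ha' : a = r
      · subst ha'
        by_cases hb : b = q
        · subst hb
          simp [ha, hqs]; omega
        · simp [ha, hb]; split_ifs <;> omega
      · simp [ha, ha', e3]
  · have := key 1 (fun t _ => by simpa using abs_sub t 1)
    linarith
  · intro h
    have := key (-1) (fun t ht => by rw [abs_of_nonneg, abs_of_pos] <;> omega)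
    linarith

lemma exists_neg_of_sum {α : Type*} [Fintype α] (f : α → ℤ) (h : ∑ a, f a = 0) (a : α)
    (ha : 0 < f a) : ∃ b, f b < 0 := by
  by_contra hc
  push Not at hc
  have := Finset.sum_pos' (fun i _ => hc i) ⟨a, Finset.mem_univ a, ha⟩
  omega

lemma mem_of_cols {R C : ℕ} (S : Finset (Fin R × Fin C)) (p r : Fin R) (q s : Fin C)
    (hpr : p ≠ r) (hqs : q ≠ s) (h : ∀ i, (i, q) ∈ S ↔ (i, s) ∈ S) :
    basicMove p r q s ∈ B0 S := by
  refine basicMove_mem S _ _ _ _ hpr hqs ?_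
  rw [basicMove_sum]
  simp only [h]
  ring

lemma mem_of_rows {R C : ℕ} (S : Finset (Fin R × Fin C)) (p r : Fin R) (q s : Fin C)
    (hpr : p ≠ r) (hqs : q ≠ s) (h : ∀ j, (p, j) ∈ S ↔ (r, j) ∈ S) :
    basicMove p r q s ∈ B0 S := by
  refine basicMove_mem S _ _ _ _ hpr hqs ?_
  rw [basicMove_sum]
  simp only [h]
  ring

/-- Opposite signs in one row, same column class. -/
lemma red_row {R C : ℕ} (S : Finset (Fin R × Fin C)) (x y : Fin R × Fin C → ℤ)
    (hx : ∀ p, 0 ≤ x p) (hy : ∀ p, 0 ≤ y p)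
    (hc : ∀ j, ∑ i, (x (i, j) - y (i, j)) = 0)
    (a : Fin R) (b d : Fin C) (hK : ∀ i, (i, b) ∈ S ↔ (i, d) ∈ S)
    (h1 : 0 < x (a, b) - y (a, b)) (h2 : x (a, d) - y (a, d) < 0) : Red S x y := by
  obtain ⟨h, hh⟩ := exists_neg_of_sum _ (hc b) a h1
  have hah : a ≠ h := by rintro rfl; omega
  have hbd : b ≠ d := by rintro rfl; omega
  obtain ⟨e1, -, e3⟩ := move_effect x y hx hy a h b d hah hbd h2 hh
  exact Red.base (mem_of_cols S a h d b hah hbd.symm fun i => (hK i).symm) e1 (e3 h1)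

/-- Opposite signs in one column, same row class. -/
lemma red_col {R C : ℕ} (S : Finset (Fin R × Fin C)) (x y : Fin R × Fin C → ℤ)
    (hx : ∀ p, 0 ≤ x p) (hy : ∀ p, 0 ≤ y p)
    (hr : ∀ i, ∑ j, (x (i, j) - y (i, j)) = 0)
    (a e : Fin R) (d : Fin C) (hJ : ∀ j, (a, j) ∈ S ↔ (e, j) ∈ S)
    (h1 : 0 < x (a, d) - y (a, d)) (h2 : x (e, d) - y (e, d) < 0) : Red S x y := by
  obtain ⟨g, hg⟩ := exists_neg_of_sum _ (hr a) d h1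
  have hdg : d ≠ g := by rintro rfl; omega
  have hae : a ≠ e := by rintro rfl; omega
  obtain ⟨e1, -, e3⟩ := move_effect x y hx hy a e d g hae hdg hg h2
  exact Red.base (mem_of_rows S a e g d hae hdg.symm hJ) e1 (e3 h1)

lemma cols_after {R C : ℕ} (x y : Fin R × Fin C → ℤ)
    (hc : ∀ j, ∑ i, (x (i, j) - y (i, j)) = 0) (p r : Fin R) (q s : Fin C) (j : Fin C) :
    ∑ i, (x (i, j) - (y (i, j) - basicMove p r q s (i, j))) = 0 := by
  have : ∀ i, x (i, j) - (y (i, j) - basicMove p r q s (i, j))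
      = (x (i, j) - y (i, j)) + basicMove p r q s (i, j) := fun i => by ring
  simp only [this]
  rw [Finset.sum_add_distrib, hc, basicMove_col, add_zero]

lemma rows_after {R C : ℕ} (x y : Fin R × Fin C → ℤ)
    (hr : ∀ i, ∑ j, (x (i, j) - y (i, j)) = 0) (p r : Fin R) (q s : Fin C) (i : Fin R) :
    ∑ j, (x (i, j) - (y (i, j) - basicMove p r q s (i, j))) = 0 := by
  have : ∀ j, x (i, j) - (y (i, j) - basicMove p r q s (i, j))
      = (x (i, j) - y (i, j)) + basicMove p r q s (i, j) := fun i => by ring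
  simp only [this]
  rw [Finset.sum_add_distrib, hr, basicMove_row, add_zero]

/-- Opposite signs in one block. -/
lemma red_block {R C : ℕ} (S : Finset (Fin R × Fin C)) (x y : Fin R × Fin C → ℤ)
    (hx : ∀ p, 0 ≤ x p) (hy : ∀ p, 0 ≤ y p)
    (hr : ∀ i, ∑ j, (x (i, j) - y (i, j)) = 0)
    (hc : ∀ j, ∑ i, (x (i, j) - y (i, j)) = 0)
    (a e : Fin R) (b d : Fin C) (hJ : ∀ j, (a, j) ∈ S ↔ (e, j) ∈ S)
    (hK : ∀ i, (i, b) ∈ S ↔ (i, d) ∈ S)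
    (h1 : 0 < x (a, b) - y (a, b)) (h2 : x (e, d) - y (e, d) < 0) : Red S x y := by
  rcases lt_trichotomy (x (a, d) - y (a, d)) 0 with h | h | h
  · exact red_row S x y hx hy hc a b d hK h1 h
  · obtain ⟨g, hg⟩ := exists_neg_of_sum _ (hr a) b h1
    have hdg : d ≠ g := by rintro rfl; omega
    have hbg : b ≠ g := by rintro rfl; omega
    have hbd : b ≠ d := by rintro rfl; omega
    have hae : a ≠ e := by rintro rfl; omega
    obtain ⟨e1, e2, -⟩ := move_effect x y hx hy a e d g hae hdg hg h2
    refine Red.step (mem_of_rows S a e g d hae hdg.symm hJ) e1 e2 ?_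
    refine red_row S x _ hx e1 (cols_after x y hc _ _ _ _) a b d hK ?_ ?_
    · simp [basicMove, hae, hbg, hbd]; omega
    · simp [basicMove, hae, hdg]; omega
  · exact red_col S x y hx hy hr a e d hJ h h2

lemma red_main {R C : ℕ} (S : Finset (Fin R × Fin C)) (x y : Fin R × Fin C → ℤ)
    (hx : ∀ p, 0 ≤ x p) (hy : ∀ p, 0 ≤ y p)
    (hr : ∀ i, ∑ j, (x (i, j) - y (i, j)) = 0)
    (hc : ∀ j, ∑ i, (x (i, j) - y (i, j)) = 0)
    (hnb : ∀ p q : Fin R × Fin C, sameBlock S p q → ¬(0 < x p - y p ∧ x q - y q < 0))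
    (i i' : Fin R) (j j' : Fin C) (hB : ∑ p ∈ S, basicMove i i' j j' p = 0)
    (h1 : ∃ q, sameBlock S (i', j) q ∧ x q - y q < 0)
    (h2 : ∃ q, sameBlock S (i, j') q ∧ x q - y q < 0)
    (h3 : ∃ q, sameBlock S (i, j) q ∧ 0 < x q - y q) : Red S x y := by
  obtain ⟨⟨c, d⟩, ⟨hc1, hd1⟩, hcd⟩ := h1
  obtain ⟨⟨e, f⟩, ⟨he1, hf1⟩, hef⟩ := h2
  obtain ⟨⟨a, b⟩, ⟨ha1, hb1⟩, hab⟩ := h3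
  simp only at hc1 hd1 he1 hf1 ha1 hb1
  have hJ : ∀ j, (a, j) ∈ S ↔ (e, j) ∈ S := fun k => (ha1 k).symm.trans (he1 k)
  have hK : ∀ i, (i, b) ∈ S ↔ (i, d) ∈ S := fun k => (hb1 k).symm.trans (hd1 k)
  have hec : e ≠ c := by
    rintro rfl
    exact hnb (a, b) (e, d) ⟨hJ, hK⟩ ⟨hab, hcd⟩
  have hdf : d ≠ f := by
    rintro rfl
    exact hnb (a, b) (e, d) ⟨hJ, hK⟩ ⟨hab, hef⟩
  have hbf : b ≠ f := by
    rintro rfl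
    exact hnb (a, b) (e, b) ⟨hJ, fun _ => Iff.rfl⟩ ⟨hab, hef⟩
  have hac : a ≠ c := by
    rintro rfl
    exact hnb (a, b) (a, d) ⟨fun _ => Iff.rfl, hK⟩ ⟨hab, hcd⟩
  have hM : basicMove e c f d ∈ B0 S := by
    refine basicMove_mem S _ _ _ _ hec hdf.symm ?_
    rw [basicMove_sum] at hB ⊢
    simp only [← he1, ← hc1, ← hd1, ← hf1]
    linarith
  obtain ⟨e1, e2, e3⟩ := move_effect x y hx hy e c d f hec hdf hef hcd
  by_cases hp : 0 < x (e, d) - y (e, d)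
  · exact Red.base hM e1 (e3 hp)
  · have h0 : ¬ (x (e, d) - y (e, d) < 0) := fun h => hnb (a, b) (e, d) ⟨hJ, hK⟩ ⟨hab, h⟩
    refine Red.step hM e1 e2 ?_
    refine red_block S x _ hx e1 (rows_after x y hr _ _ _ _) (cols_after x y hc _ _ _ _)
      a e b d hJ hK ?_ ?_
    · have : ¬ (a = e ∧ b = d) := by
        rintro ⟨rfl, rfl⟩
        exact hp hab
      simp [basicMove, hac, hbf, this]; omega
    · simp [basicMove, hec, hdf]; omega

lemma red_main' {R C : ℕ} (S : Finset (Fin R × Fin C)) (x y : Fin R × Fin C → ℤ)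
    (hx : ∀ p, 0 ≤ x p) (hy : ∀ p, 0 ≤ y p)
    (hr : ∀ i, ∑ j, (x (i, j) - y (i, j)) = 0)
    (hc : ∀ j, ∑ i, (x (i, j) - y (i, j)) = 0)
    (hnb : ∀ p q : Fin R × Fin C, sameBlock S p q → ¬(0 < x p - y p ∧ x q - y q < 0))
    (i i' : Fin R) (j j' : Fin C) (hB : ∑ p ∈ S, basicMove i i' j j' p = 0)
    (h1 : ∃ q, sameBlock S (i', j) q ∧ x q - y q < 0)
    (h2 : ∃ q, sameBlock S (i, j') q ∧ x q - y q < 0)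
    (h3 : (∃ q, sameBlock S (i, j) q ∧ 0 < x q - y q) ∨
      (∃ q, sameBlock S (i', j') q ∧ 0 < x q - y q)) : Red S x y := by
  rcases h3 with h3 | h3
  · exact red_main S x y hx hy hr hc hnb i i' j j' hB h1 h2 h3
  · refine red_main S x y hx hy hr hc hnb i' i j' j ?_ h2 h1 h3
    rw [basicMove_sum] at hB ⊢
    linarith

lemma sameBlock_symm {R C : ℕ} {S : Finset (Fin R × Fin C)} {p q : Fin R × Fin C}
    (h : sameBlock S p q) : sameBlock S q p :=
  ⟨fun k => (h.1 k).symm, fun k => (h.2 k).symm⟩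

/-- Lemma 3: for a triangular `S` and `Z = X − Y` with no block containing cells of both
signs, if four blocks arranged as a rectangle compatible with a basic move of `B₀(S)` carry
one of the sign patterns (i)–(iv), then `‖X − Y‖₁` can be reduced by `B₀(S)`. -/
theorem stmt8 {R C : ℕ} (S : Finset (Fin R × Fin C)) (hS : isTriangular S)
    (x y : Fin R × Fin C → ℕ) (hf : sameFiber S x y) (hxy : x ≠ y)
    (hnb : ∀ p q : Fin R × Fin C, sameBlock S p q →
      ¬(0 < (x p : ℤ) - (y p : ℤ) ∧ (x q : ℤ) - (y q : ℤ) < 0))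
    (i i' : Fin R) (j j' : Fin C) (hi : i ≠ i') (hj : j ≠ j')
    (hB : basicMove i i' j j' ∈ B0 S)
    (ε : ℤ) (hε : ε = 1 ∨ ε = -1)
    (h1 : ∃ q : Fin R × Fin C, sameBlock S (i', j) q ∧ ε * ((x q : ℤ) - (y q : ℤ)) < 0)
    (h2 : ∃ q : Fin R × Fin C, sameBlock S (i, j') q ∧ ε * ((x q : ℤ) - (y q : ℤ)) < 0)
    (h3 : (∃ q : Fin R × Fin C, sameBlock S (i, j) q ∧ 0 < ε * ((x q : ℤ) - (y q : ℤ))) ∨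
          (∃ q : Fin R × Fin C, sameBlock S (i', j') q ∧ 0 < ε * ((x q : ℤ) - (y q : ℤ)))) :
    normReducible S x y := by
  have hB0 : ∑ p ∈ S, basicMove i i' j j' p = 0 := by
    obtain ⟨_, _, _, _, _, _, _, hm⟩ := hB
    exact hm.2.2
  have hr : ∀ i, ∑ j, ((x (i, j) : ℤ) - (y (i, j) : ℤ)) = 0 := fun i => by
    rw [Finset.sum_sub_distrib, sub_eq_zero]
    exact_mod_cast hf.1 i
  have hc : ∀ j, ∑ i, ((x (i, j) : ℤ) - (y (i, j) : ℤ)) = 0 := fun j => by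
    rw [Finset.sum_sub_distrib, sub_eq_zero]
    exact_mod_cast hf.2.1 j
  have hx0 : ∀ p, (0 : ℤ) ≤ (x p : ℤ) := fun p => Int.natCast_nonneg _
  have hy0 : ∀ p, (0 : ℤ) ≤ (y p : ℤ) := fun p => Int.natCast_nonneg _
  rcases hε with rfl | rfl
  · simp only [one_mul] at h1 h2 h3
    obtain ⟨n, B, hn, hBm, hpos, hlt⟩ := red_main' S (fun p => (x p : ℤ)) (fun p => (y p : ℤ))
      hx0 hy0 hr hc hnb i i' j j' hB0 h1 h2 h3
    refine ⟨0, n, B, B, by omega, by simp, hBm, fun a h1 h2 => by omega, hpos, by simpa using hlt⟩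
  · have e : ∀ q, (-1 : ℤ) * ((x q : ℤ) - (y q : ℤ)) = (y q : ℤ) - (x q : ℤ) := fun q => by ring
    simp only [e] at h1 h2 h3
    obtain ⟨n, B, hn, hBm, hpos, hlt⟩ := red_main' S (fun p => (y p : ℤ)) (fun p => (x p : ℤ))
      hy0 hx0
      (fun i => by
        have := hr i
        rw [Finset.sum_sub_distrib] at this ⊢
        linarith)
      (fun j => by
        have := hc j
        rw [Finset.sum_sub_distrib] at this ⊢
        linarith)
      (fun p q hpq h => hnb q p (sameBlock_symm hpq) ⟨by linarith [h.2], by linarith [h.1]⟩)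
      i i' j j' hB0 h1 h2 h3
    refine ⟨n, 0, fun t => -B t, B, by omega, fun t ht => B0_neg S _ (hBm t ht), by simp, ?_,
      fun a h1 h2 => by omega, ?_⟩
    · intro a h1 h2 p
      simpa [Finset.sum_neg_distrib, sub_eq_add_neg] using hpos a h1 h2 p
    · refine lt_of_eq_of_lt ?_ (lt_of_lt_of_eq hlt ?_)
      · refine Finset.sum_congr rfl fun p _ => ?_
        rw [← abs_neg]
        congr 1
        simp [Finset.sum_neg_distrib]
        ring
      · exact Finset.sum_congr rfl fun p _ => abs_sub_comm _ _
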